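/- arXiv:0704.3092 — 8 statements merged into one kernel-verified Lean document; each statement's English description precedes it below -/
import Mathlib

section
/- Let X be a C*-algebra, E a norm-closed subalgebra of X, B a norm-closed subalgebra of E, D a norm-closed two-sided ideal of E, and A a norm-closed two-sided ideal of B with A ⊆ D. Suppose there is a net (e_t) in A with ‖e_t‖ ≤ 1 for all t such that ‖e_t·d − d‖ → 0 and ‖d·e_t − d‖ → 0 for every d ∈ D (a common contractive approximate identity for A and D). Then dist(b, A) = dist(b, D) for every b ∈ B; equivalently, the canonical map B/A → E/D between the quotient spaces is isometric. -/
open Filter Topology Metric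

/-- `S` is a norm-closed (not necessarily self-adjoint or unital) subalgebra:
a norm-closed ℂ-linear subspace closed under multiplication. -/
structure IsClosedSubalg (X : Type*) [NonUnitalNormedRing X] [NormedSpace ℂ X]
    (S : Set X) : Prop where
  isClosed : IsClosed S
  zero_mem : (0 : X) ∈ S
  add_mem : ∀ {x y : X}, x ∈ S → y ∈ S → x + y ∈ S
  smul_mem : ∀ (c : ℂ) {x : X}, x ∈ S → c • x ∈ S
  mul_mem : ∀ {x y : X}, x ∈ S → y ∈ S → x * y ∈ S

/-- A contractive net drawn from `A` which is a two-sided approximate identity for `D`. -/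
def IsCaiFor (X : Type*) [NonUnitalNormedRing X] (A D : Set X) : Prop :=
  ∃ (ι : Type) (l : Filter ι) (e : ι → X), l.NeBot ∧
    (∀ t, e t ∈ A) ∧ (∀ t, ‖e t‖ ≤ 1) ∧
    (∀ d ∈ D, Tendsto (fun t => ‖e t * d - d‖) l (𝓝 0)) ∧
    (∀ d ∈ D, Tendsto (fun t => ‖d * e t - d‖) l (𝓝 0))

section UnitalCStar

open scoped WithCStarModule

variable {U : Type*} [CStarAlgebra U]

lemma norm_one_le_one : ‖(1 : U)‖ ≤ 1 := by
  rcases subsingleton_or_nontrivial U with h | h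
  · simp [Subsingleton.elim (1 : U) 0]
  · simp

/-- If a contraction `m` in a C⋆-algebra almost fixes `a`, then so does its adjoint. -/
lemma norm_star_mul_sub_sq_le {m : U} (hm : ‖m‖ ≤ 1) (a : U) :
    ‖star m * a - a‖ ^ 2 ≤ 2 * ‖a‖ * ‖m * a - a‖ := by
  let _ := CStarAlgebra.spectralOrder U
  have _ := CStarAlgebra.spectralOrderedRing U
  have hmm : m * star m ≤ 1 := by
    rw [← CStarAlgebra.norm_le_one_iff_of_nonneg _ (mul_star_self_nonneg m),
      CStarRing.norm_self_mul_star]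
    nlinarith [norm_nonneg m]
  have key : star (star m * a - a) * (star m * a - a) ≤
      -(star a * (m * a - a) + star (m * a - a) * a) := by
    have := star_left_conjugate_nonneg (sub_nonneg.mpr hmm) a
    rw [← sub_nonneg]
    convert this using 1
    simp only [star_sub, star_mul, star_star]
    noncomm_ring
  calc ‖star m * a - a‖ ^ 2 = ‖star (star m * a - a) * (star m * a - a)‖ := by
        rw [CStarRing.norm_star_mul_self, sq]
    _ ≤ ‖-(star a * (m * a - a) + star (m * a - a) * a)‖ :=
        CStarAlgebra.norm_le_norm_of_nonneg_of_le (star_mul_self_nonneg _) key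
    _ ≤ ‖star a * (m * a - a)‖ + ‖star (m * a - a) * a‖ := by
        rw [norm_neg]; exact norm_add_le _ _
    _ ≤ ‖star a‖ * ‖m * a - a‖ + ‖star (m * a - a)‖ * ‖a‖ :=
        add_le_add (norm_mul_le _ _) (norm_mul_le _ _)
    _ = 2 * ‖a‖ * ‖m * a - a‖ := by rw [norm_star, norm_star]; ring

lemma norm_mul_star_sub_sq_le {m : U} (hm : ‖m‖ ≤ 1) (a : U) :
    ‖a * star m - a‖ ^ 2 ≤ 2 * ‖a‖ * ‖a * m - a‖ := by
  have h := norm_star_mul_sub_sq_le (m := star m) (by rwa [norm_star]) (star a)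
  have h₁ : star (star m) * star a - star a = star (a * star m - a) := by simp
  have h₂ : star m * star a - star a = star (a * m - a) := by simp
  rwa [h₁, h₂, norm_star, norm_star, norm_star] at h

/-- Compressions by self-adjoint `p`, `q` with `p * p + q * q = 1` combine contractively. -/
lemma norm_conj_add_conj_le {p q y₁ y₂ : U} {C : ℝ} (hp : IsSelfAdjoint p)
    (hq : IsSelfAdjoint q) (hpq : p * p + q * q = 1) (h₁ : ‖y₁‖ ≤ C) (h₂ : ‖y₂‖ ≤ C) :
    ‖p * y₁ * p + q * y₂ * q‖ ≤ C := by
  let _ := CStarAlgebra.spectralOrder U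
  have _ := CStarAlgebra.spectralOrderedRing U
  have hC : 0 ≤ C := (norm_nonneg _).trans h₁
  have bound : ∀ y : U, ‖y‖ ≤ C → y * star y ≤ algebraMap ℝ U (C ^ 2) := by
    intro y hy
    refine CStarAlgebra.mul_star_le_algebraMap_norm_sq.trans ?_
    exact algebraMap_mono U (pow_le_pow_left₀ (norm_nonneg _) hy 2)
  let v : C⋆ᵐᵒᵈ(U, U × U) := (WithCStarModule.equiv U (U × U)).symm (p, q)
  let w : C⋆ᵐᵒᵈ(U, U × U) := (WithCStarModule.equiv U (U × U)).symm (p * y₁, q * y₂)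
  have hv : ‖v‖ ≤ 1 := by
    have h : ‖v‖ ^ 2 = ‖p * star p + q * star q‖ := WithCStarModule.prod_norm_sq v
    rw [hp.star_eq, hq.star_eq, hpq] at h
    have hone := norm_one_le_one (U := U)
    nlinarith [norm_nonneg v]
  have hw : ‖w‖ ≤ C := by
    have h : ‖w‖ ^ 2 = ‖p * y₁ * star (p * y₁) + q * y₂ * star (q * y₂)‖ :=
      WithCStarModule.prod_norm_sq w
    refine le_of_sq_le_sq ?_ hC
    rw [h, CStarAlgebra.norm_le_iff_le_algebraMap _ (by positivity)
      (add_nonneg (mul_star_self_nonneg _) (mul_star_self_nonneg _))]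
    calc _ = p * (y₁ * star y₁) * p + q * (y₂ * star y₂) * q := by
          simp only [star_mul, hp.star_eq, hq.star_eq, mul_assoc]
      _ ≤ p * algebraMap ℝ U (C ^ 2) * p + q * algebraMap ℝ U (C ^ 2) * q :=
          add_le_add (hp.conjugate_le_conjugate (bound _ h₁))
            (hq.conjugate_le_conjugate (bound _ h₂))
      _ = algebraMap ℝ U (C ^ 2) := by
          rw [← Algebra.commutes, ← Algebra.commutes, mul_assoc, mul_assoc, ← mul_add, hpq,
            mul_one]
  have hin : ‖p * y₁ * star p + q * y₂ * star q‖ ≤ ‖v‖ * ‖w‖ :=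
    CStarModule.norm_inner_le (A := U) (C⋆ᵐᵒᵈ(U, U × U)) (x := v) (y := w)
  rw [hp.star_eq, hq.star_eq] at hin
  exact hin.trans ((mul_le_mul hv hw (norm_nonneg _) zero_le_one).trans_eq (one_mul C))

/-- A self-adjoint contraction `p` has a self-adjoint contractive complement `q` with
`p * p + q * q = 1`, and `q` almost fixes everything that `p * p` almost kills. -/
lemma exists_complement {p : U} (hp : IsSelfAdjoint p) (hp1 : ‖p‖ ≤ 1) :
    ∃ q : U, IsSelfAdjoint q ∧ ‖q‖ ≤ 1 ∧ p * p + q * q = 1 ∧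
      ∀ z, ‖q * z - z‖ ≤ ‖p * p * z‖ := by
  let _ := CStarAlgebra.spectralOrder U
  have _ := CStarAlgebra.spectralOrderedRing U
  have hpp : 0 ≤ p * p := hp.mul_self_nonneg
  have hpp1 : p * p ≤ 1 := by
    rw [← CStarAlgebra.norm_le_one_iff_of_nonneg _ hpp]
    exact (norm_mul_le _ _).trans (mul_le_one₀ hp1 (norm_nonneg _) hp1)
  have h0 : 0 ≤ 1 - p * p := sub_nonneg.mpr hpp1
  obtain ⟨q, hq0, hqq⟩ : ∃ q : U, 0 ≤ q ∧ q * q = 1 - p * p :=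
    ⟨CFC.sqrt (1 - p * p), CFC.sqrt_nonneg _, CFC.sqrt_mul_sqrt_self _ h0⟩
  have hq : IsSelfAdjoint q := hq0.isSelfAdjoint
  have hpp' : p * p = 1 - q * q := by rw [hqq]; abel
  refine ⟨q, hq, ?_, by rw [hqq]; abel, fun z => ?_⟩
  · have h1 : ‖q * q‖ ≤ 1 := by
      rw [CStarAlgebra.norm_le_one_iff_of_nonneg _ hq.mul_self_nonneg, hqq]
      exact sub_le_self _ hpp
    have h2 : ‖q * q‖ = ‖q‖ * ‖q‖ := by
      rw [← CStarRing.norm_star_mul_self, hq.star_eq]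
    nlinarith [norm_nonneg q]
  · refine le_of_sq_le_sq ?_ (norm_nonneg _)
    rw [sq, sq, ← CStarRing.norm_star_mul_self, ← CStarRing.norm_star_mul_self]
    refine CStarAlgebra.norm_le_norm_of_nonneg_of_le (star_mul_self_nonneg _) ?_
    have h1 : 0 ≤ q + q + q * q := add_nonneg (add_nonneg hq0 hq0) hq.mul_self_nonneg
    have h2 := star_left_conjugate_nonneg h1 (q * z - z)
    rw [← sub_nonneg]
    convert h2 using 1
    rw [hpp']
    simp only [star_sub, star_mul, star_one, hq.star_eq]
    noncomm_ring

/-- If `p` acts almost as a unit on `a` and is almost fixed by `g`, then a convex combination of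
`a` and `g` roughly halves the excess of `‖1 - a‖` over `1`. -/
lemma norm_one_sub_sub_le {a g p : U} {s δ : ℝ} (hs : 0 ≤ s) (hs1 : s ≤ 1)
    (ha : ‖1 - a‖ ≤ 1 + s) (hg : ‖g‖ ≤ 1) (hp : IsSelfAdjoint p) (hp1 : ‖p‖ ≤ 1)
    (hpa : ‖p * a - a‖ ≤ δ) (hap : ‖a * p - a‖ ≤ δ)
    (hpg : ‖p * p * (1 - g)‖ ≤ δ) (hgp : ‖(1 - g) * (p * p)‖ ≤ δ) :
    ‖1 - ((1 - s / 2) • a + (s / 2) • g)‖ ≤ 1 + s / 2 + 2 * δ := by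
  obtain ⟨q, hq, hq1, hpq, hqz⟩ := exists_complement hp hp1
  set z := 1 - g with hz
  have hqz1 : ‖q * z - z‖ ≤ δ := (hqz z).trans hpg
  have hzq1 : ‖z * q - z‖ ≤ δ := by
    have h := hqz (star z)
    have h1 : q * star z - star z = star (z * q - z) := by simp [hq.star_eq]
    have h2 : p * p * star z = star (z * (p * p)) := by simp [hp.star_eq]
    rw [h1, h2, norm_star, norm_star] at h
    exact h.trans hgp
  have conj_close : ∀ r c : U, ‖r‖ ≤ 1 → ‖r * c - c‖ ≤ δ → ‖c * r - c‖ ≤ δ →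
      ‖c - r * c * r‖ ≤ 2 * δ := by
    intro r c hr h1 h2
    have : c - r * c * r = -((r * c - c) * r + (c * r - c)) := by noncomm_ring
    rw [this, norm_neg]
    refine (norm_add_le _ _).trans ?_
    have := (norm_mul_le (r * c - c) r).trans
      (mul_le_of_le_one_right (norm_nonneg _) hr)
    linarith
  have main : ‖p * ((1 - s / 2) • (1 - a)) * p + q * (1 - (s / 2) • g) * q‖ ≤ 1 + s / 2 := by
    refine norm_conj_add_conj_le hp hq hpq ?_ ?_
    · rw [norm_smul, Real.norm_of_nonneg (by linarith)]
      nlinarith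
    · have hone := norm_one_le_one (U := U)
      refine (norm_sub_le _ _).trans (add_le_add hone ?_)
      rw [norm_smul, Real.norm_of_nonneg (by linarith)]
      nlinarith
  have decomp : 1 - ((1 - s / 2) • a + (s / 2) • g) =
      (p * ((1 - s / 2) • (1 - a)) * p + q * (1 - (s / 2) • g) * q) +
      (-((1 - s / 2) • (a - p * a * p)) + (s / 2) • (z - q * z * q)) := by
    have hpp : p * p = 1 - q * q := by rw [← hpq]; abel
    simp only [hz, mul_sub, sub_mul, mul_smul_comm, smul_mul_assoc, mul_one, smul_sub, hpp]
    module
  rw [decomp]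
  refine (norm_add_le _ _).trans (add_le_add main ((norm_add_le _ _).trans ?_))
  rw [norm_neg, norm_smul, norm_smul, Real.norm_of_nonneg (by linarith),
    Real.norm_of_nonneg (by linarith)]
  have i1 := conj_close p a hp1 hpa hap
  have i2 := conj_close q z hq1 hqz1 hzq1
  nlinarith [norm_nonneg (a - p * a * p), norm_nonneg (z - q * z * q)]

/-- If a convex set `A ⊆ D` contains a contractive approximate identity for `D`, then every
`d ∈ D` has approximate right units `a ∈ A` with `‖1 - a‖` almost at most `1`. -/
lemma exists_norm_one_sub_le {ι : Type*} {l : Filter ι} [l.NeBot] {e : ι → U} {A D : Set U}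
    (hA : Convex ℝ A) (hAD : A ⊆ D) (heA : ∀ t, e t ∈ A) (he : ∀ t, ‖e t‖ ≤ 1)
    (hl : ∀ d ∈ D, Tendsto (fun t => ‖e t * d - d‖) l (𝓝 0))
    (hr : ∀ d ∈ D, Tendsto (fun t => ‖d * e t - d‖) l (𝓝 0))
    {d : U} (hd : d ∈ D) {ε : ℝ} (hε : 0 < ε) :
    ∃ a ∈ A, ‖1 - a‖ ≤ 1 + ε ∧ ‖d * a - d‖ ≤ ε := by
  have step : ∀ n : ℕ, ∀ η : ℝ, 0 < η →
      ∃ a ∈ A, ‖1 - a‖ ≤ 1 + (3 / 4 : ℝ) ^ n ∧ ‖d * a - d‖ ≤ η := by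
    intro n
    induction n with
    | zero =>
      intro η hη
      obtain ⟨t, ht⟩ := ((hr d hd).eventually_le_const hη).exists
      refine ⟨e t, heA t, (norm_sub_le _ _).trans ?_, ht⟩
      rw [pow_zero]
      exact add_le_add norm_one_le_one (he t)
    | succ n ih =>
      intro η hη
      obtain ⟨a, haA, ha, hda⟩ := ih η hη
      set s : ℝ := (3 / 4) ^ n with hs
      have hs0 : 0 < s := by positivity
      have hs1 : s ≤ 1 := pow_le_one₀ (by norm_num) (by norm_num)
      have haD := hAD haA
      have sq_tendsto : ∀ {c : ℝ} {f g : ι → ℝ}, (∀ t, 0 ≤ f t) →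
          (∀ t, f t ^ 2 ≤ c * g t) → Tendsto g l (𝓝 0) → Tendsto f l (𝓝 0) := by
        intro c f g hf hfg hg
        have h1 : Tendsto (fun t => f t ^ 2) l (𝓝 0) :=
          squeeze_zero (fun t => sq_nonneg _) hfg (by simpa using hg.const_mul c)
        have h2 := h1.sqrt
        simpa [Real.sqrt_sq (hf _)] using h2
      have hstarl : Tendsto (fun t => ‖star (e t) * a - a‖) l (𝓝 0) :=
        sq_tendsto (fun _ => norm_nonneg _) (fun t => norm_star_mul_sub_sq_le (he t) a)
          (hl a haD)
      have hstarr : Tendsto (fun t => ‖a * star (e t) - a‖) l (𝓝 0) :=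
        sq_tendsto (fun _ => norm_nonneg _) (fun t => norm_mul_star_sub_sq_le (he t) a)
          (hr a haD)
      have hδ : 0 < s / 16 := by positivity
      obtain ⟨t, ⟨h1, h2⟩, h3, h4⟩ :=
        (((hl a haD).eventually_le_const hδ).and ((hr a haD).eventually_le_const hδ) |>.and
          ((hstarl.eventually_le_const hδ).and (hstarr.eventually_le_const hδ))).exists
      set m := e t
      have hm1 : ‖m‖ ≤ 1 := he t
      have hms : ‖star m‖ ≤ 1 := by rwa [norm_star]
      have hmD : m ∈ D := hAD (heA t)
      have hmstar : Tendsto (fun t => ‖e t * star m - star m‖) l (𝓝 0) := by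
        have hc := fun t =>
          norm_star_mul_sub_sq_le (m := star (e t)) (by rw [norm_star]; exact he t) (star m)
        refine sq_tendsto (c := 2 * ‖star m‖) (fun _ => norm_nonneg _) (fun t => ?_) (hr m hmD)
        have h := hc t
        have h' : star (e t) * star m - star m = star (m * e t - m) := by simp
        rwa [star_star, h', norm_star (m * e t - m)] at h
      obtain ⟨u, ⟨hu1, hu2⟩, hu3⟩ :=
        (((hr m hmD).eventually_le_const (by positivity : 0 < s / 8)).and
          (hmstar.eventually_le_const (by positivity : 0 < s / 8)) |>.and
          ((hr d hd).eventually_le_const hη)).exists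
      set g := e u
      have contr : ∀ x y : U, ‖x‖ ≤ 1 → ‖x * y‖ ≤ ‖y‖ := fun x y hx =>
        (norm_mul_le _ _).trans (mul_le_of_le_one_left (norm_nonneg _) hx)
      have contr' : ∀ x y : U, ‖x‖ ≤ 1 → ‖y * x‖ ≤ ‖y‖ := fun x y hx =>
        (norm_mul_le _ _).trans (mul_le_of_le_one_right (norm_nonneg _) hx)
      have hp1 : ‖star m * m‖ ≤ 1 := (contr _ _ hms).trans hm1
      refine ⟨(1 - s / 2) • a + (s / 2) • g, hA haA (heA u) (by linarith) (by linarith)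
        (by ring), ?_, ?_⟩
      · refine (norm_one_sub_sub_le (δ := s / 8) hs0.le hs1 ha (he u)
          (IsSelfAdjoint.star_mul_self m) hp1 ?_ ?_ ?_ ?_).trans ?_
        · have : star m * m * a - a = star m * (m * a - a) + (star m * a - a) := by
            noncomm_ring
          rw [this]
          linarith [norm_add_le (star m * (m * a - a)) (star m * a - a),
            contr (star m) (m * a - a) hms]
        · have : a * (star m * m) - a = (a * star m - a) * m + (a * m - a) := by
            noncomm_ring
          rw [this]
          linarith [norm_add_le ((a * star m - a) * m) (a * m - a),
            contr' m (a * star m - a) hm1]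
        · have : star m * m * (star m * m) * (1 - g) =
              -((star m * m) * (star m * (m * g - m))) := by noncomm_ring
          rw [this, norm_neg]
          exact (contr _ _ hp1).trans ((contr _ _ hms).trans hu1)
        · have : (1 - g) * (star m * m * (star m * m)) =
              -((g * star m - star m) * m * (star m * m)) := by noncomm_ring
          rw [this, norm_neg]
          exact (contr' _ _ hp1).trans ((contr' _ _ hm1).trans hu2)
        · rw [pow_succ, ← hs]; linarith
      · have : d * ((1 - s / 2) • a + (s / 2) • g) - d =
            (1 - s / 2) • (d * a - d) + (s / 2) • (d * g - d) := by
          rw [mul_add, mul_smul_comm, mul_smul_comm]; module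
        rw [this]
        refine (norm_add_le _ _).trans ?_
        rw [norm_smul, norm_smul, Real.norm_of_nonneg (by linarith),
          Real.norm_of_nonneg (by linarith)]
        nlinarith
  obtain ⟨n, hn⟩ := exists_pow_lt_of_lt_one hε (by norm_num : (3 / 4 : ℝ) < 1)
  obtain ⟨a, haA, ha, hda⟩ := step n ε hε
  exact ⟨a, haA, ha.trans (by linarith), hda⟩

end UnitalCStar

/-- If `A ⊆ D` are respectively closed two-sided ideals in `B ⊆ E`, closed subalgebras of a
C*-algebra `X`, and there is a common contractive approximate identity for `A` and `D`
(a cai for `D` lying in `A`), then `dist(b, A) = dist(b, D)` for every `b ∈ B`; i.e. the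
canonical map `B/A → E/D` is isometric. -/
theorem stmt0 {X : Type*} [NonUnitalCStarAlgebra X]
    (E B D A : Set X)
    (hE : IsClosedSubalg X E) (hB : IsClosedSubalg X B) (hBE : B ⊆ E)
    (hD : IsClosedSubalg X D) (hDE : D ⊆ E)
    (hDideal : ∀ d ∈ D, ∀ x ∈ E, d * x ∈ D ∧ x * d ∈ D)
    (hA : IsClosedSubalg X A) (hAB : A ⊆ B)
    (hAideal : ∀ a ∈ A, ∀ b ∈ B, a * b ∈ A ∧ b * a ∈ A)
    (hAD : A ⊆ D)
    (hcai : IsCaiFor X A D) :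
    ∀ b ∈ B, infDist b A = infDist b D := by
  obtain ⟨ι, l, e, hl, heA, he, hleft, hright⟩ := hcai
  intro b hb
  refine le_antisymm ?_ (infDist_le_infDist_of_subset hAD ⟨0, hA.zero_mem⟩)
  refine (le_infDist ⟨0, hD.zero_mem⟩).mpr fun d hd => ?_
  have approx : ∀ ε : ℝ, 0 < ε → infDist b A ≤ dist b d * (1 + ε) + ε := by
    intro ε hε
    have hconv : Convex ℝ ((fun x : X => (x : Unitization ℂ X)) '' A) := by
      rintro _ ⟨x, hx, rfl⟩ _ ⟨y, hy, rfl⟩ α β - - -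
      refine ⟨(α : ℂ) • x + (β : ℂ) • y,
        hA.add_mem (hA.smul_mem _ hx) (hA.smul_mem _ hy), ?_⟩
      simp only [Unitization.inr_add, Unitization.inr_smul, Complex.coe_smul]
    obtain ⟨_, ⟨a, ha, rfl⟩, h1, h2⟩ := exists_norm_one_sub_le (l := l)
      (e := fun t => (e t : Unitization ℂ X)) (D := (fun x : X => (x : Unitization ℂ X)) '' D)
      hconv (Set.image_mono hAD) (fun t => Set.mem_image_of_mem _ (heA t))
      (fun t => by rw [Unitization.norm_inr]; exact he t)
      (by
        rintro _ ⟨x, hx, rfl⟩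
        simpa only [← Unitization.inr_mul, ← Unitization.inr_sub, Unitization.norm_inr]
          using hleft x hx)
      (by
        rintro _ ⟨x, hx, rfl⟩
        simpa only [← Unitization.inr_mul, ← Unitization.inr_sub, Unitization.norm_inr]
          using hright x hx)
      (Set.mem_image_of_mem _ hd) hε
    have h2' : ‖d * a - d‖ ≤ ε := by
      simpa only [← Unitization.inr_mul, ← Unitization.inr_sub, Unitization.norm_inr] using h2
    have h3 : ‖(b - d) - (b - d) * a‖ ≤ ‖b - d‖ * (1 + ε) := by
      have : (((b - d) - (b - d) * a : X) : Unitization ℂ X) =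
          ((b - d : X) : Unitization ℂ X) * (1 - (a : Unitization ℂ X)) := by
        rw [mul_sub, mul_one, Unitization.inr_sub, Unitization.inr_mul]
      rw [← Unitization.norm_inr (𝕜 := ℂ), this]
      refine (norm_mul_le _ _).trans ?_
      rw [Unitization.norm_inr]
      exact mul_le_mul_of_nonneg_left h1 (norm_nonneg _)
    refine (infDist_le_dist_of_mem (hAideal a ha b hb).2).trans ?_
    have : b - b * a = ((b - d) - (b - d) * a) - (d * a - d) := by noncomm_ring
    rw [dist_eq_norm, dist_eq_norm, this]
    exact (norm_sub_le _ _).trans (add_le_add h3 h2')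
  have hlim : Tendsto (fun ε : ℝ => dist b d * (1 + ε) + ε) (𝓝[>] 0) (𝓝 (dist b d)) := by
    have : ContinuousAt (fun ε : ℝ => dist b d * (1 + ε) + ε) 0 := by fun_prop
    simpa [ContinuousAt] using this.tendsto.mono_left nhdsWithin_le_nhds
  refine ge_of_tendsto hlim ?_
  filter_upwards [self_mem_nhdsWithin] with ε hε using approx ε hε
end

section
/- Let X be a C*-algebra, E a norm-closed subalgebra of X, B a norm-closed subalgebra of E, D a norm-closed right ideal of E (d·x ∈ D for all d ∈ D, x ∈ E), and A a norm-closed right ideal of B (a·b ∈ A for all a ∈ A, b ∈ B) with A ⊆ D. Suppose there is a net (e_t) in A with ‖e_t‖ ≤ 1 for all t such that ‖e_t·d − d‖ → 0 for every d ∈ D (a common contractive left approximate identity for A and D). Then dist(b, A) = dist(b, D) for every b ∈ B; i.e., the canonical map B/A → E/D is isometric. -/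
open Filter Topology Metric

/-- A contractive net drawn from `A` which is a left approximate identity for `D`. -/
def IsLeftCaiFor (X : Type*) [NonUnitalNormedRing X] (A D : Set X) : Prop :=
  ∃ (ι : Type) (l : Filter ι) (e : ι → X), l.NeBot ∧
    (∀ t, e t ∈ A) ∧ (∀ t, ‖e t‖ ≤ 1) ∧
    (∀ d ∈ D, Tendsto (fun t => ‖e t * d - d‖) l (𝓝 0))

theorem norm_sub_star_mul_sq_le {X : Type*} [NonUnitalCStarAlgebra X] {e f : X}
    (he : ‖e‖ ≤ 1) (hf : ‖f‖ ≤ 1) :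
    ‖e - star f * e‖ ^ 2 ≤ 2 * ‖f * e - e‖ := by
  let _ : PartialOrder X := CStarAlgebra.spectralOrder X
  have _ : StarOrderedRing X := CStarAlgebra.spectralOrderedRing X
  have hle : star (e - star f * e) * (e - star f * e) ≤
      star e * (e - f * e) + star (star e * (e - f * e)) := by
    have h1 : star (star f * e) * (star f * e) ≤ star e * e := by
      have h := CStarAlgebra.star_left_conjugate_le_norm_smul (a := e) (b := f * star f)
        (IsSelfAdjoint.mul_star_self f)
      have h2 : ‖f * star f‖ ≤ 1 := by
        rw [CStarRing.norm_self_mul_star]; nlinarith [norm_nonneg f]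
      have h3 : ‖f * star f‖ • (star e * e) ≤ (1 : ℝ) • (star e * e) :=
        smul_le_smul_of_nonneg_right h2 (star_mul_self_nonneg e)
      rw [one_smul] at h3
      refine le_trans (le_of_eq ?_) (h.trans h3)
      simp [mul_assoc]
    rw [← sub_nonneg] at h1 ⊢
    convert h1 using 1
    simp only [star_sub, star_mul, star_star, mul_sub, sub_mul, mul_assoc]
    abel
  have hn := CStarAlgebra.norm_le_norm_of_nonneg_of_le (star_mul_self_nonneg _) hle
  rw [CStarRing.norm_star_mul_self, ← sq] at hn
  have hb : ‖star e * (e - f * e)‖ ≤ ‖f * e - e‖ := by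
    refine (norm_mul_le _ _).trans ?_
    rw [norm_star, norm_sub_rev e]
    exact mul_le_of_le_one_left (norm_nonneg _) he
  have hs := norm_add_le (star e * (e - f * e)) (star (star e * (e - f * e)))
  rw [norm_star] at hs
  linarith

theorem norm_add_sq_le_of_norm_star_mul_le {X : Type*} [NonUnitalCStarAlgebra X]
    {x e y z : X} {C r : ℝ} (hy : y = x - e * x) (hyC : ‖y‖ ≤ C) (hzC : ‖z‖ ≤ C)
    (hr : ‖star e * z‖ ≤ r) :
    ‖y + z‖ ^ 2 ≤ 2 * (C ^ 2 + ‖x‖ * C + ‖x‖ * r) := by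
  have hcross : ‖star y * z‖ ≤ ‖x‖ * C + ‖x‖ * r := by
    have h : star y * z = star x * z - star x * (star e * z) := by
      simp [hy, sub_mul, mul_assoc]
    rw [h]
    refine (norm_sub_le _ _).trans (add_le_add ?_ ?_)
    · refine (norm_mul_le _ _).trans ?_
      rw [norm_star]; gcongr
    · refine (norm_mul_le _ _).trans ?_
      rw [norm_star]; gcongr
  have hcross' : ‖star z * y‖ = ‖star y * z‖ := by
    rw [← norm_star (star z * y)]; simp
  have hexp : star (y + z) * (y + z) =
      (star y * y + star z * z) + (star y * z + star z * y) := by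
    simp only [star_add, add_mul, mul_add]; abel
  rw [sq, ← CStarRing.norm_star_mul_self, hexp]
  have h1 := norm_add_le (star y * y + star z * z) (star y * z + star z * y)
  have h2 := norm_add_le (star y * y) (star z * z)
  have h3 := norm_add_le (star y * z) (star z * y)
  rw [CStarRing.norm_star_mul_self, CStarRing.norm_star_mul_self] at h2
  nlinarith [norm_nonneg y, norm_nonneg z]

/-- Contractions in `A` acting on `D` approximately as left identities, with complement
of norm at most `C` on `x`. -/
def HasLeftUnitsBound {X : Type*} [NonUnitalNormedRing X] (A D : Set X) (x : X) (C : ℝ) : Prop :=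
  ∀ F : Finset X, (∀ f ∈ F, f ∈ D) → ∀ ε > 0,
    ∃ e ∈ A, ‖e‖ ≤ 1 ∧ (∀ f ∈ F, ‖e * f - f‖ < ε) ∧ ‖x - e * x‖ ≤ C

theorem IsLeftCaiFor.hasLeftUnitsBound {X : Type*} [NonUnitalNormedRing X] {A D : Set X}
    (h : IsLeftCaiFor X A D) (x : X) : HasLeftUnitsBound A D x (2 * ‖x‖) := by
  obtain ⟨ι, l, e, hl, heA, he1, he⟩ := h
  intro F hF ε hε
  have hev : ∀ᶠ t in l, ∀ f ∈ F, ‖e t * f - f‖ < ε :=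
    (Filter.eventually_all_finset F).2 fun f hf => (he f (hF f hf)).eventually_lt_const hε
  obtain ⟨t, ht⟩ := hev.exists
  refine ⟨e t, heA t, he1 t, ht, ?_⟩
  have h1 := norm_sub_le x (e t * x)
  have h2 := norm_mul_le (e t) x
  nlinarith [he1 t, norm_nonneg x]

theorem HasLeftUnitsBound.average {X : Type*} [NonUnitalCStarAlgebra X] {A D : Set X}
    (hA : IsClosedSubalg X A) (hAD : A ⊆ D) {x : X} {C C' : ℝ}
    (h : HasLeftUnitsBound A D x C) (hC' : 0 ≤ C') (hlt : C ^ 2 + ‖x‖ * C < 2 * C' ^ 2) :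
    HasLeftUnitsBound A D x C' := by
  classical
  intro F hF ε hε
  obtain ⟨r, hr, hrC⟩ : ∃ r > 0, C ^ 2 + ‖x‖ * C + ‖x‖ * (r * ‖x‖) ≤ 2 * C' ^ 2 := by
    refine ⟨(2 * C' ^ 2 - (C ^ 2 + ‖x‖ * C)) / (‖x‖ ^ 2 + 1),
      div_pos (by linarith) (by positivity), ?_⟩
    have hk : ‖x‖ ^ 2 / (‖x‖ ^ 2 + 1) ≤ 1 := (div_le_one (by positivity)).2 (by linarith)
    have hm := mul_le_mul_of_nonneg_left hk (sub_nonneg.2 hlt.le)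
    calc _ = C ^ 2 + ‖x‖ * C +
          (2 * C' ^ 2 - (C ^ 2 + ‖x‖ * C)) * (‖x‖ ^ 2 / (‖x‖ ^ 2 + 1)) := by ring
      _ ≤ _ := by linarith
  obtain ⟨e, heA, he1, heF, hex⟩ := h F hF ε hε
  obtain ⟨f, hfA, hf1, hfF, hfx⟩ := h (insert e F)
    (by simpa using ⟨hAD heA, hF⟩) (min ε (r ^ 2 / 2)) (by positivity)
  have hfe : ‖f * e - e‖ < r ^ 2 / 2 :=
    (hfF e (Finset.mem_insert_self e F)).trans_le (min_le_right _ _)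
  have horth : ‖star e * (x - f * x)‖ ≤ r * ‖x‖ := by
    have heq : star e * (x - f * x) = star (e - star f * e) * x := by
      simp [sub_mul, mul_sub, mul_assoc]
    have hle : ‖e - star f * e‖ ≤ r :=
      le_of_sq_le_sq (by linarith [norm_sub_star_mul_sq_le he1 hf1]) hr.le
    rw [heq]
    refine (norm_mul_le _ _).trans ?_
    rw [norm_star]
    gcongr
  have hsum := norm_add_sq_le_of_norm_star_mul_le rfl hex hfx horth
  have hhalf : ∀ y : X, ‖(1 / 2 : ℂ) • y‖ = ‖y‖ / 2 := fun y => by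
    rw [norm_smul]; norm_num; ring
  have havg : ∀ y : X, (1 / 2 : ℂ) • (e + f) * y - y =
      (1 / 2 : ℂ) • ((e * y - y) + (f * y - y)) := fun y => by
    rw [smul_mul_assoc, add_mul]; module
  refine ⟨(1 / 2 : ℂ) • (e + f), hA.smul_mem _ (hA.add_mem heA hfA), ?_, ?_, ?_⟩
  · rw [hhalf]
    linarith [norm_add_le e f]
  · intro g hg
    rw [havg, hhalf]
    have h1 := norm_add_le (e * g - g) (f * g - g)
    have h2 := heF g hg
    have h3 := (hfF g (Finset.mem_insert_of_mem hg)).trans_le (min_le_left _ _)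
    linarith
  · rw [norm_sub_rev, havg, hhalf]
    have h1 : ‖(e * x - x) + (f * x - x)‖ = ‖(x - e * x) + (x - f * x)‖ := by
      rw [← norm_neg]; congr 1; abel
    rw [h1]
    have h2 : ‖(x - e * x) + (x - f * x)‖ ≤ 2 * C' :=
      le_of_sq_le_sq (by nlinarith) (by positivity)
    linarith

theorem IsLeftCaiFor.hasLeftUnitsBound_of_norm_lt {X : Type*} [NonUnitalCStarAlgebra X]
    {A D : Set X} (hA : IsClosedSubalg X A) (hAD : A ⊆ D) (h : IsLeftCaiFor X A D)
    {x : X} {C : ℝ} (hC : ‖x‖ < C) : HasLeftUnitsBound A D x C := by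
  set S : Set ℝ := {C | HasLeftUnitsBound A D x C}
  have hne : S.Nonempty := ⟨_, h.hasLeftUnitsBound x⟩
  have hbdd : BddBelow S := by
    refine ⟨0, fun c hc => ?_⟩
    obtain ⟨e, -, -, -, hex⟩ := hc ∅ (by simp) 1 one_pos
    exact (norm_nonneg _).trans hex
  have hinf : sInf S ≤ ‖x‖ := by
    by_contra! hlt
    have hx := norm_nonneg x
    have hcont : Tendsto (fun c : ℝ => c ^ 2 + ‖x‖ * c) (𝓝 (sInf S))
        (𝓝 (sInf S ^ 2 + ‖x‖ * sInf S)) := Continuous.tendsto (by fun_prop) _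
    have hev := hcont.eventually_lt_const
      (show sInf S ^ 2 + ‖x‖ * sInf S < 2 * sInf S ^ 2 by nlinarith)
    obtain ⟨δ, hδ, hball⟩ := Metric.eventually_nhds_iff.1 hev
    obtain ⟨c, hcS, hc⟩ := exists_lt_of_csInf_lt hne (lt_add_of_pos_right (sInf S) hδ)
    have hcb : c ^ 2 + ‖x‖ * c < 2 * sInf S ^ 2 := by
      refine hball ?_
      rw [Real.dist_eq, abs_of_nonneg (sub_nonneg.2 (csInf_le hbdd hcS))]
      linarith
    have hcont' : Tendsto (fun c : ℝ => 2 * c ^ 2) (𝓝 (sInf S)) (𝓝 (2 * sInf S ^ 2)) :=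
      Continuous.tendsto (by fun_prop) _
    have hev' := ((hcont'.eventually_const_lt hcb).and
      (lt_mem_nhds (hx.trans_lt hlt))).filter_mono (nhdsWithin_le_nhds (s := Set.Iio (sInf S)))
    obtain ⟨c', ⟨hc', hpos⟩, hlt'⟩ := (hev'.and self_mem_nhdsWithin).exists
    exact (csInf_le hbdd (HasLeftUnitsBound.average hA hAD hcS hpos.le hc')).not_gt hlt'
  obtain ⟨c, hcS, hc⟩ := exists_lt_of_csInf_lt hne (hinf.trans_lt hC)
  intro F hF ε hε
  obtain ⟨e, heA, he1, heF, hex⟩ := hcS F hF ε hε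
  exact ⟨e, heA, he1, heF, hex.trans hc.le⟩

/-- One-sided version: if `A ⊆ D` are norm-closed right ideals in `B ⊆ E`, closed subalgebras
of a C*-algebra `X`, with a common contractive left approximate identity (a contractive left
approximate identity for `D` drawn from `A`), then `dist(b, A) = dist(b, D)` for every
`b ∈ B`; i.e. the canonical map `B/A → E/D` is isometric. -/
theorem stmt1 {X : Type*} [NonUnitalCStarAlgebra X]
    (E B D A : Set X)
    (hE : IsClosedSubalg X E) (hB : IsClosedSubalg X B) (hBE : B ⊆ E)
    (hD : IsClosedSubalg X D) (hDE : D ⊆ E)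
    (hDideal : ∀ d ∈ D, ∀ x ∈ E, d * x ∈ D)
    (hA : IsClosedSubalg X A) (hAB : A ⊆ B)
    (hAideal : ∀ a ∈ A, ∀ b ∈ B, a * b ∈ A)
    (hAD : A ⊆ D)
    (hcai : IsLeftCaiFor X A D) :
    ∀ b ∈ B, infDist b A = infDist b D := by
  intro b hb
  refine le_antisymm ?_ (infDist_le_infDist_of_subset hAD ⟨0, hA.zero_mem⟩)
  refine (le_infDist ⟨0, hD.zero_mem⟩).2 fun d hd => ?_
  refine le_of_forall_pos_le_add fun ε hε => ?_
  obtain ⟨e, heA, -, hed, hex⟩ := hcai.hasLeftUnitsBound_of_norm_lt hA hAD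
    (show ‖b - d‖ < ‖b - d‖ + ε / 2 by linarith) {d} (by simpa using hd) (ε / 2) (half_pos hε)
  have hed' := hed d (Finset.mem_singleton_self d)
  refine (infDist_le_dist_of_mem (hAideal e heA b hb)).trans ?_
  rw [dist_eq_norm, dist_eq_norm]
  have heq : b - e * b = ((b - d) - e * (b - d)) - (e * d - d) := by
    rw [mul_sub]; abel
  rw [heq]
  linarith [norm_sub_le ((b - d) - e * (b - d)) (e * d - d)]
end

section
/- Let X be a C*-algebra, E a norm-closed subalgebra of X, D a norm-closed two-sided ideal of E, and B a norm-closed subalgebra of E. Suppose there is a net (e_t) in B ∩ D with ‖e_t‖ ≤ 1 for all t such that ‖e_t·d − d‖ → 0 and ‖d·e_t − d‖ → 0 for every d ∈ D (a contractive approximate identity for D lying in B). Then the set B + D = {b + d : b ∈ B, d ∈ D} is norm-closed in X; equivalently, the image of B under the quotient map E → E/D is closed. -/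
open Filter Topology Metric

/-- The additive subgroup underlying a norm-closed subalgebra. -/
def IsClosedSubalg.toAddSubgroup {X : Type*} [NonUnitalNormedRing X] [NormedSpace ℂ X]
    {S : Set X} (hS : IsClosedSubalg X S) : AddSubgroup X where
  carrier := S
  zero_mem' := hS.zero_mem
  add_mem' := hS.add_mem
  neg_mem' := fun {x} hx => by simpa using hS.smul_mem (-1) hx

/-- If addition `P × Q → X` admits norm-controlled preimages over `P + Q`, where `P` and `Q` are
closed subgroups of a complete normed group, then `P + Q` is closed. -/
theorem AddSubgroup.isClosed_sup_of_controlled {X : Type*} [NormedAddCommGroup X]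
    [CompleteSpace X] {P Q : AddSubgroup X} (hP : IsClosed (P : Set X))
    (hQ : IsClosed (Q : Set X)) {C : ℝ} (hC : 0 < C)
    (h : ∀ y ∈ P ⊔ Q, ∃ p ∈ P, ∃ q ∈ Q, p + q = y ∧ ‖p‖ ≤ C * ‖y‖ ∧ ‖q‖ ≤ C * ‖y‖) :
    IsClosed ((P ⊔ Q : AddSubgroup X) : Set X) := by
  have : CompleteSpace P := hP.completeSpace_coe
  have : CompleteSpace Q := hQ.completeSpace_coe
  let f : NormedAddGroupHom (P × Q) X :=
    (P.subtype.coprod Q.subtype).mkNormedAddGroupHom 2 fun z => by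
      calc ‖(z.1 : X) + z.2‖ ≤ ‖z.1‖ + ‖z.2‖ := norm_add_le _ _
        _ ≤ 2 * ‖z‖ := by linarith [norm_fst_le z, norm_snd_le z]
  have hf : f.SurjectiveOnWith (P ⊔ Q) C := fun y hy => by
    obtain ⟨p, hp, q, hq, hpq, hpC, hqC⟩ := h y hy
    exact ⟨(⟨p, hp⟩, ⟨q, hq⟩), hpq, max_le hpC hqC⟩
  refine isClosed_of_closure_subset fun x hx => ?_
  obtain ⟨z, hz, -⟩ := controlled_closure_of_complete hC one_pos hf x hx
  rw [← hz]
  exact AddSubgroup.add_mem_sup z.1.2 z.2.2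

/-- If `D` is a closed two-sided ideal in a closed subalgebra `E` of a C*-algebra `X`, and a
closed subalgebra `B` of `E` contains a contractive approximate identity for `D` (i.e. there
is a cai for `D` drawn from `B ∩ D`), then `B + D` is norm-closed; equivalently the image of
`B` in `E/D` is closed. -/
theorem stmt2 {X : Type*} [NonUnitalCStarAlgebra X]
    (E D B : Set X)
    (hE : IsClosedSubalg X E)
    (hD : IsClosedSubalg X D) (hDE : D ⊆ E)
    (hDideal : ∀ d ∈ D, ∀ x ∈ E, d * x ∈ D ∧ x * d ∈ D)
    (hB : IsClosedSubalg X B) (hBE : B ⊆ E)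
    (hcai : IsCaiFor X (B ∩ D) D) :
    IsClosed {x : X | ∃ b ∈ B, ∃ d ∈ D, x = b + d} := by
  obtain ⟨ι, l, e, hl, he, he1, -, her⟩ := hcai
  let P := hB.toAddSubgroup
  let Q := hD.toAddSubgroup
  have hset : {x : X | ∃ b ∈ B, ∃ d ∈ D, x = b + d} = ((P ⊔ Q : AddSubgroup X) : Set X) := by
    ext x
    simp only [Set.mem_ofPred_eq, SetLike.mem_coe, AddSubgroup.mem_sup]
    exact ⟨fun ⟨b, hb, d, hd, h⟩ => ⟨b, hb, d, hd, h.symm⟩,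
      fun ⟨b, hb, d, hd, h⟩ => ⟨b, hb, d, hd, h.symm⟩⟩
  rw [hset]
  refine AddSubgroup.isClosed_sup_of_controlled hB.isClosed hD.isClosed
    (C := 4) (by norm_num) fun y hy => ?_
  obtain ⟨b, hb, d, hd, rfl⟩ := AddSubgroup.mem_sup.1 hy
  rcases eq_or_ne (b + d) 0 with h0 | h0
  · exact ⟨0, P.zero_mem, 0, Q.zero_mem, by simp [h0]⟩
  obtain ⟨t, ht⟩ := ((her d hd).eventually_lt_const (norm_pos_iff.2 h0)).exists
  have hbe : b * e t ∈ D := (hDideal _ (he t).2 b (hBE hb)).2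
  have hye : ‖(b + d) * e t‖ ≤ ‖b + d‖ :=
    (norm_mul_le _ _).trans (mul_le_of_le_one_right (norm_nonneg _) (he1 t))
  refine ⟨b - b * e t, P.sub_mem hb (hB.mul_mem hb (he t).1), d + b * e t,
    Q.add_mem hd hbe, by abel, ?_, ?_⟩
  · have hdecomp : b - b * e t = (b + d) - (b + d) * e t + (d * e t - d) := by
      rw [add_mul]; abel
    rw [hdecomp]
    linarith [norm_add_le ((b + d) - (b + d) * e t) (d * e t - d),
      norm_sub_le (b + d) ((b + d) * e t), norm_nonneg (b + d)]
  · have hdecomp : d + b * e t = (b + d) * e t - (d * e t - d) := by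
      rw [add_mul]; abel
    rw [hdecomp]
    linarith [norm_sub_le ((b + d) * e t) (d * e t - d), norm_nonneg (b + d)]
end

section
/- Let X be a C*-algebra, B a norm-closed subalgebra of X, and A a norm-closed two-sided ideal of B admitting a contractive approximate identity. Let J be the C*-subalgebra of X generated by A (the smallest norm-closed self-adjoint subalgebra of X containing A) and let G be the C*-subalgebra of X generated by B. Then J is a two-sided ideal of G: for every g ∈ G and j ∈ J, both g·j ∈ J and j·g ∈ J. -/
open Filter Topology Metric

/-- The C*-subalgebra of `X` generated by a subset `S`: the smallest norm-closed subalgebra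
of `X` containing `S` and closed under the involution, realized as the intersection of all
norm-closed star-closed subalgebras containing `S`. -/
def cstarGen (X : Type*) [NonUnitalNormedRing X] [NormedSpace ℂ X] [Star X]
    (S : Set X) : Set X :=
  ⋂₀ {J : Set X | IsClosedSubalg X J ∧ (∀ x ∈ J, star x ∈ J) ∧ S ⊆ J}

/-- A left approximation `e * a ≈ a` by a contraction passes to the adjoint of `e`. -/
theorem norm_star_mul_sub_sq_le_s4 {X : Type*} [NonUnitalCStarAlgebra X] (e a : X) (he : ‖e‖ ≤ 1) :
    ‖star e * a - a‖ ^ 2 ≤ 2 * ‖a‖ * ‖e * a - a‖ := by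
  let _ := CStarAlgebra.spectralOrder X
  have := CStarAlgebra.spectralOrderedRing X
  have hconj : star a * (e * star e) * a ≤ star a * a := by
    refine (CStarAlgebra.star_left_conjugate_le_norm_smul
      (a := a) (b := e * star e) (IsSelfAdjoint.mul_star_self e)).trans ?_
    have h1 : ‖e * star e‖ ≤ 1 := by
      rw [CStarRing.norm_self_mul_star]
      nlinarith [norm_nonneg e]
    exact smul_le_of_le_one_left (star_mul_self_nonneg a) h1
  set c := star a * (a - e * a) with hc
  have hle : star (star e * a - a) * (star e * a - a) ≤ c + star c := by
    have h : c + star c - star (star e * a - a) * (star e * a - a)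
        = star a * a - star a * (e * star e) * a := by
      simp only [hc, star_mul, star_sub, star_star, mul_sub, sub_mul, mul_assoc]
      abel
    rw [← sub_nonneg, h]
    exact sub_nonneg.mpr hconj
  have hnorm := CStarAlgebra.norm_le_norm_of_nonneg_of_le (star_mul_self_nonneg _) hle
  rw [CStarRing.norm_star_mul_self] at hnorm
  have hcn : ‖c‖ ≤ ‖a‖ * ‖e * a - a‖ := by
    simpa [norm_sub_rev a] using norm_mul_le (star a) (a - e * a)
  have := norm_add_le c (star c)
  rw [norm_star] at this
  nlinarith

theorem tendsto_star_mul_of_contractive {X ι : Type*} [NonUnitalCStarAlgebra X] {l : Filter ι}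
    {e : ι → X} {a : X} (he : ∀ t, ‖e t‖ ≤ 1)
    (h : Tendsto (fun t => ‖e t * a - a‖) l (𝓝 0)) :
    Tendsto (fun t => star (e t) * a) l (𝓝 a) := by
  rw [tendsto_iff_norm_sub_tendsto_zero]
  have h2 : Tendsto (fun t => ‖star (e t) * a - a‖ ^ 2) l (𝓝 0) :=
    squeeze_zero (fun t => by positivity) (fun t => norm_star_mul_sub_sq_le_s4 (e t) a (he t))
      (by simpa using h.const_mul (2 * ‖a‖))
  simpa [Real.sqrt_sq] using h2.sqrt

theorem tendsto_mul_star_of_contractive {X ι : Type*} [NonUnitalCStarAlgebra X] {l : Filter ι}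
    {e : ι → X} {a : X} (he : ∀ t, ‖e t‖ ≤ 1)
    (h : Tendsto (fun t => ‖a * e t - a‖) l (𝓝 0)) :
    Tendsto (fun t => a * star (e t)) l (𝓝 a) := by
  have h' : Tendsto (fun t => star (star (e t)) * star a) l (𝓝 (star a)) :=
    tendsto_star_mul_of_contractive (e := fun t => star (e t)) (by simpa using he)
      (by simpa [← star_mul, ← star_sub] using h)
  simpa using h'.star

section Generated

variable {X : Type*} [NonUnitalCStarAlgebra X] {S : Set X}

theorem subset_cstarGen : S ⊆ cstarGen X S :=
  fun _ hx _ hJ => hJ.2.2 hx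

theorem cstarGen_subset {J : Set X} (hJ : IsClosedSubalg X J) (hstar : ∀ x ∈ J, star x ∈ J)
    (hS : S ⊆ J) : cstarGen X S ⊆ J :=
  fun _ hx => hx J ⟨hJ, hstar, hS⟩

theorem isClosedSubalg_cstarGen : IsClosedSubalg X (cstarGen X S) where
  isClosed := isClosed_sInter fun _ hJ => hJ.1.isClosed
  zero_mem := fun _ hJ => hJ.1.zero_mem
  add_mem := fun hx hy J hJ => hJ.1.add_mem (hx J hJ) (hy J hJ)
  smul_mem := fun c _ hx J hJ => hJ.1.smul_mem c (hx J hJ)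
  mul_mem := fun hx hy J hJ => hJ.1.mul_mem (hx J hJ) (hy J hJ)

theorem star_mem_cstarGen {x : X} (hx : x ∈ cstarGen X S) : star x ∈ cstarGen X S :=
  fun J hJ => hJ.2.1 x (hx J hJ)

/-- An element multiplies `cstarGen X S` into itself as soon as it and its adjoint
multiply the generators into it. -/
theorem mul_mem_cstarGen_of_generators {b : X}
    (h : ∀ a ∈ S, (b * a ∈ cstarGen X S ∧ a * b ∈ cstarGen X S) ∧
      star b * a ∈ cstarGen X S ∧ a * star b ∈ cstarGen X S)
    {j : X} (hj : j ∈ cstarGen X S) : b * j ∈ cstarGen X S ∧ j * b ∈ cstarGen X S := by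
  have hJ := isClosedSubalg_cstarGen (S := S)
  let N : Set X := {j | j ∈ cstarGen X S ∧ (b * j ∈ cstarGen X S ∧ j * b ∈ cstarGen X S) ∧
    star b * j ∈ cstarGen X S ∧ j * star b ∈ cstarGen X S}
  have hN : IsClosedSubalg X N :=
    { isClosed := hJ.isClosed.inter <|
        ((hJ.isClosed.preimage (continuous_const_mul b)).inter
          (hJ.isClosed.preimage (continuous_mul_const b))).inter
        ((hJ.isClosed.preimage (continuous_const_mul (star b))).inter
          (hJ.isClosed.preimage (continuous_mul_const (star b))))
      zero_mem := by simp [N, hJ.zero_mem]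
      add_mem := by
        rintro x y ⟨hx, ⟨h1, h2⟩, h3, h4⟩ ⟨hy, ⟨k1, k2⟩, k3, k4⟩
        simp only [N, Set.mem_ofPred_eq, mul_add, add_mul]
        exact ⟨hJ.add_mem hx hy, ⟨hJ.add_mem h1 k1, hJ.add_mem h2 k2⟩,
          hJ.add_mem h3 k3, hJ.add_mem h4 k4⟩
      smul_mem := by
        rintro c x ⟨hx, ⟨h1, h2⟩, h3, h4⟩
        simp only [N, Set.mem_ofPred_eq, mul_smul_comm, smul_mul_assoc]
        exact ⟨hJ.smul_mem c hx, ⟨hJ.smul_mem c h1, hJ.smul_mem c h2⟩,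
          hJ.smul_mem c h3, hJ.smul_mem c h4⟩
      mul_mem := by
        rintro x y ⟨hx, ⟨h1, _⟩, h3, _⟩ ⟨hy, ⟨_, k2⟩, _, k4⟩
        refine ⟨hJ.mul_mem hx hy, ⟨?_, ?_⟩, ?_, ?_⟩
        · simpa only [mul_assoc] using hJ.mul_mem h1 hy
        · simpa only [mul_assoc] using hJ.mul_mem hx k2
        · simpa only [mul_assoc] using hJ.mul_mem h3 hy
        · simpa only [mul_assoc] using hJ.mul_mem hx k4 }
  have hstar : ∀ x ∈ N, star x ∈ N := by
    rintro x ⟨hx, ⟨h1, h2⟩, h3, h4⟩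
    refine ⟨star_mem_cstarGen hx, ⟨?_, ?_⟩, ?_, ?_⟩
    · simpa using star_mem_cstarGen h4
    · simpa using star_mem_cstarGen h3
    · simpa using star_mem_cstarGen h2
    · simpa using star_mem_cstarGen h1
  exact (cstarGen_subset hN hstar (fun a ha => ⟨subset_cstarGen ha, h a ha⟩) hj).2.1

/-- The elements multiplying `cstarGen X S` into itself form a C*-subalgebra, so it suffices to
check generators. -/
theorem mul_mem_cstarGen_of_mem_cstarGen {T : Set X}
    (h : ∀ b ∈ T, ∀ j ∈ cstarGen X S, b * j ∈ cstarGen X S ∧ j * b ∈ cstarGen X S)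
    {g : X} (hg : g ∈ cstarGen X T) {j : X} (hj : j ∈ cstarGen X S) :
    g * j ∈ cstarGen X S ∧ j * g ∈ cstarGen X S := by
  have hJ := isClosedSubalg_cstarGen (S := S)
  let M : Set X := {g | ∀ j ∈ cstarGen X S, g * j ∈ cstarGen X S ∧ j * g ∈ cstarGen X S}
  have hM : IsClosedSubalg X M :=
    { isClosed := by
        simp only [M, Set.ofPred_forall]
        exact isClosed_biInter fun j _ =>
          (hJ.isClosed.preimage (continuous_mul_const j)).inter
            (hJ.isClosed.preimage (continuous_const_mul j))
      zero_mem := by simp [M, hJ.zero_mem]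
      add_mem := by
        intro x y hx hy j hj
        rw [add_mul, mul_add]
        exact ⟨hJ.add_mem (hx j hj).1 (hy j hj).1, hJ.add_mem (hx j hj).2 (hy j hj).2⟩
      smul_mem := by
        intro c x hx j hj
        rw [smul_mul_assoc, mul_smul_comm]
        exact ⟨hJ.smul_mem c (hx j hj).1, hJ.smul_mem c (hx j hj).2⟩
      mul_mem := by
        intro x y hx hy j hj
        rw [mul_assoc, ← mul_assoc j]
        exact ⟨(hx _ (hy j hj).1).1, (hy _ (hx j hj).2).2⟩ }
  have hstar : ∀ x ∈ M, star x ∈ M := fun x hx j hj =>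
    ⟨by simpa using star_mem_cstarGen (hx _ (star_mem_cstarGen hj)).2,
      by simpa using star_mem_cstarGen (hx _ (star_mem_cstarGen hj)).1⟩
  exact cstarGen_subset hM hstar h hg j hj

end Generated

/-- If `A` is a closed two-sided ideal, with a contractive approximate identity, in a closed
subalgebra `B` of a C*-algebra `X`, then the C*-subalgebra `J` of `X` generated by `A` is a
two-sided ideal in the C*-subalgebra `G` of `X` generated by `B`. -/
theorem stmt4 {X : Type*} [NonUnitalCStarAlgebra X]
    (B A : Set X)
    (hB : IsClosedSubalg X B)
    (hA : IsClosedSubalg X A) (hAB : A ⊆ B)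
    (hAideal : ∀ a ∈ A, ∀ b ∈ B, a * b ∈ A ∧ b * a ∈ A)
    (hcai : IsCaiFor X A A) :
    ∀ g ∈ cstarGen X B, ∀ j ∈ cstarGen X A,
      g * j ∈ cstarGen X A ∧ j * g ∈ cstarGen X A := by
  obtain ⟨ι, l, e, _, heA, he, hl, hr⟩ := hcai
  have hJ := isClosedSubalg_cstarGen (S := A)
  refine fun g hg j hj => mul_mem_cstarGen_of_mem_cstarGen (fun b hb j hj =>
    mul_mem_cstarGen_of_generators (fun a ha => ⟨⟨subset_cstarGen (hAideal a ha b hb).2,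
      subset_cstarGen (hAideal a ha b hb).1⟩, ?_, ?_⟩) hj) hg hj
  · refine hJ.isClosed.mem_of_tendsto
      ((tendsto_star_mul_of_contractive he (hl a ha)).const_mul (star b)) (.of_forall fun t => ?_)
    rw [← mul_assoc, ← star_mul]
    exact hJ.mul_mem (star_mem_cstarGen (subset_cstarGen (hAideal _ (heA t) b hb).1))
      (subset_cstarGen ha)
  · refine hJ.isClosed.mem_of_tendsto
      ((tendsto_mul_star_of_contractive he (hr a ha)).mul_const (star b)) (.of_forall fun t => ?_)
    rw [mul_assoc, ← star_mul]
    exact hJ.mul_mem (subset_cstarGen ha)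
      (star_mem_cstarGen (subset_cstarGen (hAideal _ (heA t) b hb).2))
end

section
/- Let X be a C*-algebra, E a norm-closed subalgebra of X, D a norm-closed two-sided ideal of E, and A a norm-closed subalgebra of D. Suppose there is a net (e_t) in A with ‖e_t‖ ≤ 1 for all t such that ‖e_t·d − d‖ → 0 and ‖d·e_t − d‖ → 0 for every d ∈ D (A contains a contractive approximate identity for D). Then S := {b ∈ E : b·a ∈ A and a·b ∈ A for all a ∈ A} is a norm-closed subalgebra of E containing A, and S ∩ D = A. -/
open Filter Topology Metric

/-- Let `D` be a closed two-sided ideal in a closed subalgebra `E` of a C*-algebra `X`, and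
`A` a closed subalgebra of `D` containing a contractive approximate identity for `D`.  Then
`S := {b ∈ E : bA ⊆ A and Ab ⊆ A}` is a norm-closed subalgebra of `E` containing `A`, and
`S ∩ D = A`. -/
theorem stmt7 {X : Type*} [NonUnitalCStarAlgebra X]
    (E D A : Set X)
    (hE : IsClosedSubalg X E)
    (hD : IsClosedSubalg X D) (hDE : D ⊆ E)
    (hDideal : ∀ d ∈ D, ∀ x ∈ E, d * x ∈ D ∧ x * d ∈ D)
    (hA : IsClosedSubalg X A) (hAD : A ⊆ D)
    (hcai : IsCaiFor X A D) :
    IsClosedSubalg X {b ∈ E | ∀ a ∈ A, b * a ∈ A ∧ a * b ∈ A} ∧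
    A ⊆ {b ∈ E | ∀ a ∈ A, b * a ∈ A ∧ a * b ∈ A} ∧
    {b ∈ E | ∀ a ∈ A, b * a ∈ A ∧ a * b ∈ A} ∩ D = A := by
  refine ⟨⟨?_, ?_, ?_, ?_, ?_⟩, ?_, ?_⟩
  · have h : {b ∈ E | ∀ a ∈ A, b * a ∈ A ∧ a * b ∈ A} =
        E ∩ ⋂ a ∈ A, ((fun b => b * a) ⁻¹' A ∩ (fun b => a * b) ⁻¹' A) := by
      ext b
      simp
    rw [h]
    exact hE.isClosed.inter (isClosed_biInter fun a _ =>
      (hA.isClosed.preimage (continuous_id.mul continuous_const)).inter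
        (hA.isClosed.preimage (continuous_const.mul continuous_id)))
  · exact ⟨hE.zero_mem, fun a _ => by simp [hA.zero_mem]⟩
  · intro x y hx hy
    refine ⟨hE.add_mem hx.1 hy.1, fun a ha => ?_⟩
    rw [add_mul, mul_add]
    exact ⟨hA.add_mem (hx.2 a ha).1 (hy.2 a ha).1, hA.add_mem (hx.2 a ha).2 (hy.2 a ha).2⟩
  · intro c x hx
    refine ⟨hE.smul_mem c hx.1, fun a ha => ?_⟩
    rw [smul_mul_assoc, mul_smul_comm]
    exact ⟨hA.smul_mem c (hx.2 a ha).1, hA.smul_mem c (hx.2 a ha).2⟩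
  · intro x y hx hy
    refine ⟨hE.mul_mem hx.1 hy.1, fun a ha => ?_⟩
    rw [mul_assoc, ← mul_assoc a]
    exact ⟨(hx.2 _ (hy.2 a ha).1).1, (hy.2 _ (hx.2 a ha).2).2⟩
  · exact fun b hb => ⟨hDE (hAD hb), fun a ha => ⟨hA.mul_mem hb ha, hA.mul_mem ha hb⟩⟩
  · refine Set.Subset.antisymm ?_ fun b hb =>
      ⟨⟨hDE (hAD hb), fun a ha => ⟨hA.mul_mem hb ha, hA.mul_mem ha hb⟩⟩, hAD hb⟩
    rintro b ⟨hb, hbD⟩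
    obtain ⟨ι, l, e, hl, heA, -, hleft, -⟩ := hcai
    have hlim : Tendsto (fun t => e t * b) l (𝓝 b) :=
      tendsto_iff_norm_sub_tendsto_zero.2 (hleft b hbD)
    exact hA.isClosed.mem_of_tendsto hlim (Eventually.of_forall fun t => (hb.2 _ (heA t)).2)
end

section
/- Let X be a C*-algebra, E a norm-closed subalgebra of X, D a norm-closed two-sided ideal of E, and A a norm-closed subalgebra of D containing a net (e_t) with ‖e_t‖ ≤ 1 for all t such that ‖e_t·d − d‖ → 0 and ‖d·e_t − d‖ → 0 for every d ∈ D. Then for every norm-closed subalgebra B' of E with B' ∩ D = A one has the formula B' = {b ∈ E : (∃ b₀ ∈ B' with b − b₀ ∈ D) and (b·a ∈ A and a·b ∈ A for all a ∈ A)}. (That is, the middle term of a subextension with first term A is uniquely determined by its image in E/D.) -/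
open Filter Topology Metric

/-- Let `D` be a closed two-sided ideal in a closed subalgebra `E` of a C*-algebra `X`, and
`A` a closed subalgebra of `D` containing a contractive approximate identity for `D`.  Then
every closed subalgebra `B'` of `E` with `B' ∩ D = A` is recovered from its image modulo
`D` by the formula
`B' = {b ∈ E : (∃ b₀ ∈ B', b - b₀ ∈ D) and bA ⊆ A and Ab ⊆ A}`. -/
theorem stmt8 {X : Type*} [NonUnitalCStarAlgebra X]
    (E D A : Set X)
    (hE : IsClosedSubalg X E)
    (hD : IsClosedSubalg X D) (hDE : D ⊆ E)
    (hDideal : ∀ d ∈ D, ∀ x ∈ E, d * x ∈ D ∧ x * d ∈ D)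
    (hA : IsClosedSubalg X A) (hAD : A ⊆ D)
    (hcai : IsCaiFor X A D)
    (B' : Set X) (hB' : IsClosedSubalg X B') (hB'E : B' ⊆ E)
    (hB'D : B' ∩ D = A) :
    B' = {b ∈ E | (∃ b₀ ∈ B', b - b₀ ∈ D) ∧ ∀ a ∈ A, b * a ∈ A ∧ a * b ∈ A} := by
  have hAB : A ⊆ B' := fun a ha => (hB'D.symm ▸ ha : a ∈ B' ∩ D).1
  have mul_mem_A : ∀ b ∈ B', ∀ a ∈ A, b * a ∈ A ∧ a * b ∈ A := fun b hb a ha => by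
    have hD' := hDideal a (hAD ha) b (hB'E hb)
    rw [← hB'D]
    exact ⟨⟨hB'.mul_mem hb (hAB ha), hD'.2⟩, ⟨hB'.mul_mem (hAB ha) hb, hD'.1⟩⟩
  have sub_mem_A : ∀ x ∈ A, ∀ y ∈ A, x - y ∈ A := fun x hx y hy => by
    simpa [sub_eq_add_neg] using hA.add_mem hx (hA.smul_mem (-1) hy)
  ext b
  refine ⟨fun hb => ⟨hB'E hb, ⟨b, hb, by simpa using hD.zero_mem⟩, mul_mem_A b hb⟩, ?_⟩
  rintro ⟨-, ⟨b₀, hb₀, hd⟩, hbA⟩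
  obtain ⟨ι, l, e, hl, heA, -, -, hright⟩ := hcai
  have hmem : ∀ t, (b - b₀) * e t ∈ A := fun t => by
    rw [sub_mul]
    exact sub_mem_A _ (hbA _ (heA t)).1 _ (mul_mem_A b₀ hb₀ _ (heA t)).1
  have hlim : Tendsto (fun t => (b - b₀) * e t) l (𝓝 (b - b₀)) :=
    tendsto_iff_norm_sub_tendsto_zero.2 (hright _ hd)
  have hdA : b - b₀ ∈ A := hA.isClosed.mem_of_tendsto hlim (Eventually.of_forall hmem)
  simpa using hB'.add_mem (hAB hdA) hb₀
end

section
/- Let X be a C*-algebra, E a norm-closed subalgebra of X, D a norm-closed two-sided ideal of E, and A a norm-closed subalgebra of D containing a net (e_t) with ‖e_t‖ ≤ 1 for all t such that ‖e_t·d − d‖ → 0 and ‖d·e_t − d‖ → 0 for every d ∈ D. If B₁ and B₂ are norm-closed subalgebras of E with B₁ ∩ D = A = B₂ ∩ D and B₁ + D = B₂ + D, then B₁ = B₂. -/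
open Filter Topology Metric

/-- If `A ⊆ D` contains a left approximate identity for the ideal `D` and `B₁`, `B₂` both meet `D`
in `A`, then `B₁ + D ⊆ B₂ + D` forces `B₁ ⊆ B₂`. -/
theorem IsClosedSubalg.subset_of_subset_add {X : Type*} [NonUnitalNormedRing X] [NormedSpace ℂ X]
    {E D A B₁ B₂ : Set X}
    (hDideal : ∀ d ∈ D, ∀ x ∈ E, d * x ∈ D ∧ x * d ∈ D)
    (hA : IsClosedSubalg X A) (hcai : IsCaiFor X A D)
    (hB₁ : IsClosedSubalg X B₁) (hB₁E : B₁ ⊆ E)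
    (hB₂ : IsClosedSubalg X B₂) (hB₂E : B₂ ⊆ E)
    (hB₁D : B₁ ∩ D = A) (hB₂D : B₂ ∩ D = A)
    (h : ∀ x ∈ B₁, ∃ b ∈ B₂, ∃ d ∈ D, x = b + d) : B₁ ⊆ B₂ := by
  obtain ⟨ι, l, e, hl, heA, -, hleft, -⟩ := hcai
  intro x hx
  obtain ⟨b, hb, d, hd, rfl⟩ := h x hx
  have he₁ : ∀ t, e t ∈ B₁ ∩ D := fun t => hB₁D ▸ heA t
  have he₂ : ∀ t, e t ∈ B₂ ∩ D := fun t => hB₂D ▸ heA t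
  have hmem : ∀ t, e t * d ∈ A := fun t => by
    have h₁ : e t * (b + d) ∈ A :=
      hB₁D ▸ ⟨hB₁.mul_mem (he₁ t).1 hx, (hDideal _ (he₁ t).2 _ (hB₁E hx)).1⟩
    have h₂ : e t * b ∈ A :=
      hB₂D ▸ ⟨hB₂.mul_mem (he₂ t).1 hb, (hDideal _ (he₂ t).2 _ (hB₂E hb)).1⟩
    have h₃ := hA.add_mem h₁ (hA.smul_mem (-1) h₂)
    rwa [mul_add, neg_one_smul, add_neg_cancel_comm] at h₃
  have hdA : d ∈ A :=
    hA.isClosed.mem_of_tendsto (tendsto_iff_norm_sub_tendsto_zero.2 (hleft d hd))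
      (Eventually.of_forall hmem)
  rw [← hB₂D] at hdA
  exact hB₂.add_mem hb hdA.1

/-- Let `D` be a closed two-sided ideal in a closed subalgebra `E` of a C*-algebra `X`, and
`A` a closed subalgebra of `D` containing a contractive approximate identity for `D`.  If
two closed subalgebras `B₁, B₂` of `E` satisfy `B₁ ∩ D = A = B₂ ∩ D` and
`B₁ + D = B₂ + D`, then `B₁ = B₂`: a subextension with first term `A` is determined by its
last term. -/
theorem stmt9 {X : Type*} [NonUnitalCStarAlgebra X]
    (E D A : Set X)
    (hE : IsClosedSubalg X E)
    (hD : IsClosedSubalg X D) (hDE : D ⊆ E)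
    (hDideal : ∀ d ∈ D, ∀ x ∈ E, d * x ∈ D ∧ x * d ∈ D)
    (hA : IsClosedSubalg X A) (hAD : A ⊆ D)
    (hcai : IsCaiFor X A D)
    (B₁ B₂ : Set X)
    (hB₁ : IsClosedSubalg X B₁) (hB₁E : B₁ ⊆ E)
    (hB₂ : IsClosedSubalg X B₂) (hB₂E : B₂ ⊆ E)
    (hB₁D : B₁ ∩ D = A) (hB₂D : B₂ ∩ D = A)
    (hsum : {x : X | ∃ b ∈ B₁, ∃ d ∈ D, x = b + d} =
            {x : X | ∃ b ∈ B₂, ∃ d ∈ D, x = b + d}) :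
    B₁ = B₂ := by
  have hadd : ∀ {B : Set X}, ∀ x ∈ B, ∃ b ∈ B, ∃ d ∈ D, x = b + d :=
    fun x hx => ⟨x, hx, 0, hD.zero_mem, (add_zero x).symm⟩
  refine Set.Subset.antisymm ?_ ?_
  · exact IsClosedSubalg.subset_of_subset_add hDideal hA hcai hB₁ hB₁E hB₂ hB₂E hB₁D hB₂D
      fun x hx => hsum.subset (hadd x hx)
  · exact IsClosedSubalg.subset_of_subset_add hDideal hA hcai hB₂ hB₂E hB₁ hB₁E hB₂D hB₁D
      fun x hx => hsum.superset (hadd x hx)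
end

section
/- Let X₁ and X₂ be C*-algebras, B₁ ⊆ X₁ and B₂ ⊆ X₂ norm-closed subalgebras, and A₁, A₂ norm-closed two-sided ideals of B₁ and B₂ respectively, each admitting a contractive approximate identity. Let ρ : B₁ → B₂ be a ℂ-linear multiplicative map with ‖ρ(b)‖ ≤ ‖b‖ for all b ∈ B₁ and ρ(A₁) ⊆ A₂. If ‖ρ(a)‖ = ‖a‖ for all a ∈ A₁, and dist(ρ(b), A₂) = dist(b, A₁) for all b ∈ B₁, then ‖ρ(b)‖ = ‖b‖ for all b ∈ B₁. (Five lemma variant: in a morphism of extensions 0 → A_i → B_i → B_i/A_i → 0, if the two outer vertical maps are isometric then so is the middle one.) -/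
open Filter Topology Metric

/-- If a contractive net `e` acts on `y` from the left as an approximate unit, then so does the
net of adjoints. -/
lemma tendsto_star_mul_of_tendsto_mul {X ι : Type*} [NonUnitalCStarAlgebra X] {l : Filter ι}
    {e : ι → X} (he : ∀ t, ‖e t‖ ≤ 1) {y : X} (hy : Tendsto (fun t => e t * y) l (𝓝 y)) :
    Tendsto (fun t => star (e t) * y) l (𝓝 y) := by
  let _ := CStarAlgebra.spectralOrder X
  let _ := CStarAlgebra.spectralOrderedRing X
  let w : ι → X := fun t => star (e t) * y - y
  let v : ι → X := fun t =>
    star y * y + star y * y - star y * (e t * y) - star (e t * y) * y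
  have hwv (t : ι) : star (w t) * w t ≤ v t := by
    have hee : ‖e t * star (e t)‖ ≤ 1 := by
      rw [CStarRing.norm_self_mul_star]
      exact mul_le_one₀ (he t) (norm_nonneg _) (he t)
    have hconj : star y * (e t * star (e t)) * y ≤ star y * y :=
      (CStarAlgebra.star_left_conjugate_le_norm_smul (.mul_star_self (e t))).trans <|
        (smul_le_smul_of_nonneg_right hee (star_mul_self_nonneg y)).trans_eq (one_smul ℝ _)
    have hw : star (w t) * w t =
        star y * (e t * star (e t)) * y + (star y * y - star y * (e t * y)
          - star (e t * y) * y) := by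
      simp only [w, star_sub, star_mul, star_star]
      noncomm_ring
    have hv : v t = star y * y + (star y * y - star y * (e t * y) - star (e t * y) * y) := by
      simp only [v]
      abel
    rw [hw, hv]
    gcongr
  have hv : Tendsto v l (𝓝 0) := by
    have h := ((tendsto_const_nhds (x := star y * y + star y * y)).sub
      (hy.const_mul (star y))).sub (hy.star.mul_const y)
    simpa [v] using h
  have hww : Tendsto (fun t => ‖w t‖ * ‖w t‖) l (𝓝 0) :=
    squeeze_zero (fun t => by positivity)
      (fun t => by
        rw [← CStarRing.norm_star_mul_self]
        exact CStarAlgebra.norm_le_norm_of_nonneg_of_le (star_mul_self_nonneg _) (hwv t))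
      (tendsto_zero_iff_norm_tendsto_zero.mp hv)
  rw [tendsto_iff_norm_sub_tendsto_zero]
  simpa [w, Real.sqrt_mul_self] using hww.sqrt

/-- The right ideal of elements on which the net `e` acts from the left as an approximate unit. -/
def leftApproxFixed {X ι : Type*} [NonUnitalNormedRing X] (l : Filter ι) (e : ι → X) : Set X :=
  {y | Tendsto (fun t => e t * y) l (𝓝 y)}

namespace leftApproxFixed

variable {X ι : Type*} {l : Filter ι} {e : ι → X}

section NormedRing

variable [NonUnitalNormedRing X] {x y : X}

lemma add_mem (hx : x ∈ leftApproxFixed l e) (hy : y ∈ leftApproxFixed l e) :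
    x + y ∈ leftApproxFixed l e := by
  simpa only [leftApproxFixed, Set.mem_ofPred_eq, mul_add] using Tendsto.add hx hy

lemma mul_mem_right (hx : x ∈ leftApproxFixed l e) (y : X) : x * y ∈ leftApproxFixed l e := by
  simpa only [leftApproxFixed, Set.mem_ofPred_eq, mul_assoc] using Tendsto.mul_const y hx

lemma isClosed_of_norm_le_one (he : ∀ t, ‖e t‖ ≤ 1) : IsClosed (leftApproxFixed l e) := by
  have hlip (t : ι) : LipschitzWith 1 (fun y => e t * y) :=
    LipschitzWith.of_dist_le_mul fun x y => by
      rw [dist_eq_norm, dist_eq_norm, ← mul_sub]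
      exact (norm_mul_le _ _).trans (mul_le_mul_of_nonneg_right (he t) (norm_nonneg _))
  exact (LipschitzWith.uniformEquicontinuous _ 1 hlip).equicontinuous.isClosed_setOfPred_tendsto
    continuous_id

/-- Left multiplication by `b` preserves the approximately fixed elements, with norm at most `M`,
as soon as this can be tested after inserting an approximate unit `f`. -/
lemma mul_mem_left [l.NeBot] (he : ∀ t, ‖e t‖ ≤ 1) {f : ι → X} {b : X} {M : ℝ}
    (hf : Tendsto (fun t => f t * y) l (𝓝 y)) (hmem : ∀ t, b * f t ∈ leftApproxFixed l e)
    (hM : ∀ t, ‖b * f t‖ ≤ M) : b * y ∈ leftApproxFixed l e ∧ ‖b * y‖ ≤ M * ‖y‖ := by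
  have hlim : Tendsto (fun t => b * f t * y) l (𝓝 (b * y)) := by
    simpa only [mul_assoc] using hf.const_mul b
  refine ⟨(isClosed_of_norm_le_one he).mem_of_tendsto hlim
    (.of_forall fun t => mul_mem_right (hmem t) y), le_of_tendsto hlim.norm (.of_forall fun t => ?_)⟩
  exact (norm_mul_le _ _).trans (mul_le_mul_of_nonneg_right (hM t) (norm_nonneg y))

end NormedRing

variable [NonUnitalCStarAlgebra X]

lemma norm_le_three_mul [l.NeBot] (he : ∀ t, ‖e t‖ ≤ 1)
    (hstar : ∀ t, star (e t) ∈ leftApproxFixed l e) {c x : X} {K : ℝ} (hc : IsSelfAdjoint c)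
    (hK : ∀ y ∈ leftApproxFixed l e, ‖c * y‖ ≤ K * ‖y‖) (hx : ‖x‖ ≤ K)
    (hcx : c - x ∈ leftApproxFixed l e) : ‖c‖ ≤ 3 * K := by
  have hK0 : 0 ≤ K := (norm_nonneg x).trans hx
  have hlim : Tendsto (fun t => 3 * K + ‖(c - x) - e t * (c - x)‖) l (𝓝 (3 * K)) := by
    simpa using (tendsto_const_nhds (x := c - x)).sub hcx |>.norm.const_add (3 * K)
  refine ge_of_tendsto hlim (.of_forall fun t => ?_)
  have hec : ‖e t * c‖ ≤ K := by
    rw [← norm_star, star_mul, hc.star_eq]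
    exact (hK _ (hstar t)).trans (mul_le_of_le_one_right hK0 (by simpa using he t))
  have hex : ‖e t * x‖ ≤ K :=
    (norm_mul_le _ _).trans ((mul_le_of_le_one_left (norm_nonneg x) (he t)).trans hx)
  calc ‖c‖ = ‖e t * c + (x - e t * x) + ((c - x) - e t * (c - x))‖ := by
        congr 1
        noncomm_ring
    _ ≤ ‖e t * c‖ + (‖x‖ + ‖e t * x‖) + ‖(c - x) - e t * (c - x)‖ :=
        (norm_add_le _ _).trans (by gcongr; exact (norm_add_le _ _).trans (by
          gcongr; exact norm_sub_le _ _))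
    _ ≤ 3 * K + ‖(c - x) - e t * (c - x)‖ := by linarith

/-- The constant `3` of `norm_le_three_mul` is removed by repeated squaring. -/
lemma norm_le_of_isSelfAdjoint [l.NeBot] (he : ∀ t, ‖e t‖ ≤ 1)
    (hstar : ∀ t, star (e t) ∈ leftApproxFixed l e) {c x : X} {K : ℝ} (hc : IsSelfAdjoint c)
    (hK : ∀ y ∈ leftApproxFixed l e, c * y ∈ leftApproxFixed l e ∧ ‖c * y‖ ≤ K * ‖y‖)
    (hx : ‖x‖ ≤ K) (hcx : c - x ∈ leftApproxFixed l e) : ‖c‖ ≤ K := by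
  have hpow (k : ℕ) : ∀ {c x : X} {K : ℝ}, IsSelfAdjoint c →
      (∀ y ∈ leftApproxFixed l e, c * y ∈ leftApproxFixed l e ∧ ‖c * y‖ ≤ K * ‖y‖) →
      ‖x‖ ≤ K → c - x ∈ leftApproxFixed l e → ‖c‖ ^ 2 ^ k ≤ 3 * K ^ 2 ^ k := by
    induction k with
    | zero =>
      intro c x K hc hK hx hcx
      simpa using norm_le_three_mul he hstar hc (fun y hy => (hK y hy).2) hx hcx
    | succ k ih =>
      intro c x K hc hK hx hcx
      have hK0 : 0 ≤ K := (norm_nonneg x).trans hx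
      have h := ih (c := c * c) (x := x * x) (K := K * K) (by simp [IsSelfAdjoint, hc.star_eq])
        (fun y hy => by
          obtain ⟨h₁, h₁'⟩ := hK y hy
          obtain ⟨h₂, h₂'⟩ := hK _ h₁
          rw [mul_assoc]
          refine ⟨h₂, h₂'.trans ?_⟩
          rw [mul_assoc]
          exact mul_le_mul_of_nonneg_left h₁' hK0)
        ((norm_mul_le _ _).trans (mul_le_mul hx hx (norm_nonneg _) hK0))
        (by
          have : c * c - x * x = c * (c - x) + (c - x) * x := by noncomm_ring
          rw [this]
          exact add_mem (hK _ hcx).1 (mul_mem_right hcx x))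
      have hcc : ‖c * c‖ = ‖c‖ ^ 2 := by
        rw [sq, ← CStarRing.norm_star_mul_self, hc.star_eq]
      rwa [hcc, ← sq, ← pow_mul, ← pow_mul, ← pow_succ'] at h
  have hK0 : 0 ≤ K := (norm_nonneg x).trans hx
  by_contra! hlt
  rcases hK0.eq_or_lt with rfl | hKpos
  · have h := hpow 0 hc hK hx hcx
    simp only [pow_zero, pow_one, mul_zero] at h
    exact hlt.not_ge h
  · have hratio : 1 < ‖c‖ / K := (one_lt_div hKpos).mpr hlt
    obtain ⟨n, hn⟩ := pow_unbounded_of_one_lt 3 hratio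
    have h := hpow n hc hK hx hcx
    rw [← div_le_iff₀ (pow_pos hKpos _), ← div_pow] at h
    exact (hn.trans_le (pow_le_pow_right₀ hratio.le n.lt_two_pow_self.le)).not_ge h

end leftApproxFixed

/-- In a C⋆-algebra, the norm of an element `b` which multiplies a set `A` having a contractive
approximate identity into itself is controlled by its action on `A` and its distance to `A`. -/
lemma IsCaiFor.norm_le {X : Type*} [NonUnitalCStarAlgebra X] {A : Set X} (hA : IsCaiFor X A A)
    {a b : X} {M : ℝ} (hleft : ∀ x ∈ A, ‖x‖ ≤ 1 → b * x ∈ A ∧ ‖b * x‖ ≤ M)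
    (hright : ∀ x ∈ A, ‖x‖ ≤ 1 → x * b ∈ A ∧ ‖x * b‖ ≤ M) (ha : a ∈ A) (hab : ‖b - a‖ ≤ M) :
    ‖b‖ ≤ M := by
  obtain ⟨ι, l, e, _, heA, he, hel, her⟩ := hA
  have hM : 0 ≤ M := (norm_nonneg _).trans hab
  have hmem (x : X) (hx : x ∈ A) : x ∈ leftApproxFixed l e :=
    tendsto_iff_norm_sub_tendsto_zero.mpr (hel x hx)
  have hmem_star (x : X) (hx : x ∈ A) : star x ∈ leftApproxFixed l e := by
    have h := (tendsto_iff_norm_sub_tendsto_zero.mpr (her x hx)).star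
    simp only [star_mul] at h
    simpa [leftApproxFixed] using
      tendsto_star_mul_of_tendsto_mul (e := fun t => star (e t)) (by simpa using he) h
  have hb (y : X) (hy : y ∈ leftApproxFixed l e) :
      b * y ∈ leftApproxFixed l e ∧ ‖b * y‖ ≤ M * ‖y‖ :=
    leftApproxFixed.mul_mem_left he hy (fun t => hmem _ (hleft _ (heA t) (he t)).1)
      fun t => (hleft _ (heA t) (he t)).2
  have hb_star (y : X) (hy : y ∈ leftApproxFixed l e) :
      star b * y ∈ leftApproxFixed l e ∧ ‖star b * y‖ ≤ M * ‖y‖ :=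
    leftApproxFixed.mul_mem_left he (tendsto_star_mul_of_tendsto_mul he hy)
      (fun t => by simpa using hmem_star _ (hright _ (heA t) (he t)).1)
      fun t => by rw [← star_mul, norm_star]; exact (hright _ (heA t) (he t)).2
  have h := leftApproxFixed.norm_le_of_isSelfAdjoint he (fun t => hmem_star _ (heA t))
    (x := star (b - a) * (b - a)) (.star_mul_self b) (K := M * M)
    (fun y hy => by
      obtain ⟨h₁, h₁'⟩ := hb y hy
      obtain ⟨h₂, h₂'⟩ := hb_star _ h₁
      rw [mul_assoc]
      refine ⟨h₂, h₂'.trans ?_⟩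
      rw [mul_assoc]
      exact mul_le_mul_of_nonneg_left h₁' hM)
    (by rw [CStarRing.norm_star_mul_self]; exact mul_le_mul hab hab (norm_nonneg _) hM)
    (by
      have : star b * b - star (b - a) * (b - a) = star b * a + star a * (b - a) := by
        rw [star_sub]
        noncomm_ring
      rw [this]
      exact leftApproxFixed.add_mem (hb_star a (hmem a ha)).1
        (leftApproxFixed.mul_mem_right (hmem_star a ha) _))
  rw [CStarRing.norm_star_mul_self] at h
  exact (mul_self_le_mul_self_iff (norm_nonneg b) hM).mpr h

/-- Five lemma, complete isometry case: given a morphism `ρ : B₁ → B₂` between closed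
subalgebras of C*-algebras (a contractive ℂ-linear multiplicative map, encoded as a map
`X₁ → X₂` whose behaviour matters only on `B₁`), carrying the approximately unital closed
two-sided ideal `A₁` of `B₁` into the corresponding ideal `A₂` of `B₂`, if `ρ` is isometric
on `A₁` and the induced map `B₁/A₁ → B₂/A₂` is isometric (`dist(ρ(b), A₂) = dist(b, A₁)`),
then `ρ` is isometric on `B₁`. -/
theorem stmt10 {X₁ X₂ : Type*} [NonUnitalCStarAlgebra X₁] [NonUnitalCStarAlgebra X₂]
    (B₁ A₁ : Set X₁) (B₂ A₂ : Set X₂)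
    (hB₁ : IsClosedSubalg X₁ B₁) (hB₂ : IsClosedSubalg X₂ B₂)
    (hA₁ : IsClosedSubalg X₁ A₁) (hA₁B : A₁ ⊆ B₁)
    (hA₁ideal : ∀ a ∈ A₁, ∀ b ∈ B₁, a * b ∈ A₁ ∧ b * a ∈ A₁)
    (hcai₁ : IsCaiFor X₁ A₁ A₁)
    (hA₂ : IsClosedSubalg X₂ A₂) (hA₂B : A₂ ⊆ B₂)
    (hA₂ideal : ∀ a ∈ A₂, ∀ b ∈ B₂, a * b ∈ A₂ ∧ b * a ∈ A₂)
    (hcai₂ : IsCaiFor X₂ A₂ A₂)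
    (ρ : X₁ → X₂)
    (hmap : ∀ b ∈ B₁, ρ b ∈ B₂)
    (hadd : ∀ x ∈ B₁, ∀ y ∈ B₁, ρ (x + y) = ρ x + ρ y)
    (hsmul : ∀ (c : ℂ), ∀ x ∈ B₁, ρ (c • x) = c • ρ x)
    (hmul : ∀ x ∈ B₁, ∀ y ∈ B₁, ρ (x * y) = ρ x * ρ y)
    (hcontr : ∀ b ∈ B₁, ‖ρ b‖ ≤ ‖b‖)
    (hAmap : ∀ a ∈ A₁, ρ a ∈ A₂)
    (hAiso : ∀ a ∈ A₁, ‖ρ a‖ = ‖a‖)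
    (hQiso : ∀ b ∈ B₁, infDist (ρ b) A₂ = infDist b A₁) :
    ∀ b ∈ B₁, ‖ρ b‖ = ‖b‖ := by
  intro b hb
  refine (hcontr b hb).antisymm (le_of_forall_pos_le_add fun ε hε => ?_)
  have hdist : infDist b A₁ < ‖ρ b‖ + ε := by
    rw [← hQiso b hb]
    exact (infDist_le_dist_of_mem hA₂.zero_mem).trans_lt (by simpa using hε)
  obtain ⟨a, ha, hab⟩ := (infDist_lt_iff ⟨0, hA₁.zero_mem⟩).mp hdist
  refine hcai₁.norm_le (fun x hx hx1 => ?_) (fun x hx hx1 => ?_) ha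
    (by rw [← dist_eq_norm]; exact hab.le)
  · have hmem := (hA₁ideal x hx b hb).2
    refine ⟨hmem, ?_⟩
    rw [← hAiso _ hmem, hmul b hb x (hA₁B hx)]
    have h := mul_le_of_le_one_right (norm_nonneg (ρ b)) ((hAiso x hx).trans_le hx1)
    linarith [norm_mul_le (ρ b) (ρ x)]
  · have hmem := (hA₁ideal x hx b hb).1
    refine ⟨hmem, ?_⟩
    rw [← hAiso _ hmem, hmul x (hA₁B hx) b hb]
    have h := mul_le_of_le_one_left (norm_nonneg (ρ b)) ((hAiso x hx).trans_le hx1)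
    linarith [norm_mul_le (ρ x) (ρ b)]
end
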